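/- Let μ_n = μ(E_n)^{−1} μ|_{E_n}, where E_n is the union over the H_n periodic points of the inscribed parallelograms E_{n,i} of the ellipses R_{n,i}. Then μ(E_n) = (|γ − β|/√((1+β²)(1+γ²))) e^{−2nτ}, and for every ball B ⊂ 𝕋² there is a constant C > 1 with C^{−1} ≤ liminf_n μ_n(B)/μ(B) ≤ limsup_n μ_n(B)/μ(B) ≤ C, where μ is Lebesgue measure on 𝕋². -/

import Mathlib

open Filter MeasureTheory
open scoped ENNReal

noncomputable def intVec (z : Fin 2 → ℤ) : EuclideanSpace ℝ (Fin 2) :=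
  (WithLp.equiv 2 (Fin 2 → ℝ)).symm fun i => (z i : ℝ)

noncomputable def eigVec (γ : ℝ) : EuclideanSpace ℝ (Fin 2) :=
  (WithLp.equiv 2 (Fin 2 → ℝ)).symm ![1, γ]

/-- The lift to `ℝ²` of the set of `n`-periodic points of `T x = A x (mod 1)`. -/
noncomputable def periodicLift (A : Matrix (Fin 2) (Fin 2) ℤ) (n : ℕ) :
    Set (EuclideanSpace ℝ (Fin 2)) :=
  {x | ∃ z : Fin 2 → ℤ,
    Matrix.toEuclideanLin ((A ^ n).map (Int.cast : ℤ → ℝ) - 1) x = intVec z}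

/-- The inscribed parallelogram `E_{n,i}` of the ellipse `R_{n,i}` centred at
the periodic point `p`, with side lengths `λ_{n,2} = e^{-τn}/|λ₂ⁿ-1|` and
`λ_{n,1} = e^{-τn}/|1-λ₁ⁿ|` in the eigendirections `(1,γ)`, `(1,β)`. -/
noncomputable def inscribedPar (l₁ l₂ γ β τ : ℝ) (n : ℕ)
    (p : EuclideanSpace ℝ (Fin 2)) : Set (EuclideanSpace ℝ (Fin 2)) :=
  {x | ∃ t s : ℝ,
    |t| ≤ Real.exp (-τ * n) / |l₂ ^ n - 1| / 2 ∧
    |s| ≤ Real.exp (-τ * n) / |1 - l₁ ^ n| / 2 ∧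
    x = p + (t / Real.sqrt (1 + γ ^ 2)) • eigVec γ
      + (s / Real.sqrt (1 + β ^ 2)) • eigVec β}

/-- `E_n`: the (lift of the) union of the inscribed parallelograms over the
`n`-periodic points. -/
noncomputable def EnSet (A : Matrix (Fin 2) (Fin 2) ℤ) (l₁ l₂ γ β τ : ℝ)
    (n : ℕ) : Set (EuclideanSpace ℝ (Fin 2)) :=
  ⋃ p ∈ periodicLift A n, inscribedPar l₁ l₂ γ β τ n p

/-- The unit cube `[0,1)²`, a fundamental domain for `𝕋²`. -/
def unitCube : Set (EuclideanSpace ℝ (Fin 2)) :=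
  {x | ∀ i, x i ∈ Set.Ico (0 : ℝ) 1}

theorem intVec_apply (z : Fin 2 → ℤ) (i : Fin 2) : intVec z i = z i := rfl

theorem intVec_add (z w : Fin 2 → ℤ) : intVec (z + w) = intVec z + intVec w := by
  ext i; simp [intVec_apply]

theorem sub_intVec_mem_unitCube_iff (x : EuclideanSpace ℝ (Fin 2)) (k : Fin 2 → ℤ) :
    x - intVec k ∈ unitCube ↔ k = fun i => ⌊x i⌋ := by
  simp only [unitCube, Set.mem_ofPred_eq, Set.mem_Ico, PiLp.sub_apply, intVec_apply, funext_iff]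
  refine forall_congr' fun i => ?_
  rw [eq_comm, Int.floor_eq_iff]
  constructor <;> rintro ⟨h, h'⟩ <;> constructor <;> linarith

theorem measurableSet_unitCube : MeasurableSet unitCube := by
  have : unitCube = ⋂ i : Fin 2, (fun x : EuclideanSpace ℝ (Fin 2) => x i) ⁻¹' Set.Ico 0 1 := by
    ext x; simp [unitCube]
  rw [this]
  exact MeasurableSet.iInter fun i => measurableSet_Ico.preimage (by fun_prop)

theorem volume_unitCube : volume unitCube = 1 := by
  have h : unitCube = (WithLp.ofLp : EuclideanSpace ℝ (Fin 2) → Fin 2 → ℝ) ⁻¹'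
      (Set.univ.pi fun _ => Set.Ico (0 : ℝ) 1) := by
    ext x; simp [unitCube]
  rw [h, (PiLp.volume_preserving_ofLp (Fin 2)).measure_preimage
    (MeasurableSet.univ_pi fun _ => measurableSet_Ico).nullMeasurableSet, Real.volume_pi_Ico]
  simp

/-- The translates of a set by the integer lattice, cut by the unit cube, have total volume that
of the set. -/
theorem tsum_volume_translate_inter_unitCube {S : Set (EuclideanSpace ℝ (Fin 2))}
    (hS : MeasurableSet S) :
    ∑' k : Fin 2 → ℤ, volume ((fun x => x - intVec k) ⁻¹' S ∩ unitCube) = volume S := by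
  have hm : ∀ k : Fin 2 → ℤ, MeasurableSet (S ∩ (fun x => x + intVec k) ⁻¹' unitCube) := fun k =>
    hS.inter (measurableSet_unitCube.preimage (by fun_prop))
  have h1 : ∀ k : Fin 2 → ℤ, volume ((fun x => x - intVec k) ⁻¹' S ∩ unitCube)
      = volume (S ∩ (fun x => x + intVec k) ⁻¹' unitCube) := by
    intro k
    rw [← measure_preimage_add_right volume (-intVec k)
      (S ∩ (fun x => x + intVec k) ⁻¹' unitCube)]
    congr 1
    ext x
    simp [sub_eq_add_neg]
  have hmem : ∀ (k : Fin 2 → ℤ) (x : EuclideanSpace ℝ (Fin 2)),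
      x + intVec k ∈ unitCube ↔ -k = fun i => ⌊x i⌋ := by
    intro k x
    rw [← sub_intVec_mem_unitCube_iff]
    have : intVec (-k) = -intVec k := by ext i; simp [intVec_apply]
    rw [this, sub_neg_eq_add]
  rw [tsum_congr h1, ← measure_iUnion _ hm]
  · congr 1
    ext x
    simp only [Set.mem_iUnion, Set.mem_inter_iff, Set.mem_preimage, hmem]
    constructor
    · rintro ⟨_, h, _⟩; exact h
    · intro h; exact ⟨-fun i => ⌊x i⌋, h, neg_neg _⟩
  · intro k l hkl
    rw [Function.onFun, Set.disjoint_left]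
    rintro x ⟨_, h⟩ ⟨_, h'⟩
    rw [Set.mem_preimage, hmem] at h h'
    exact hkl (neg_injective (h.trans h'.symm))

/-- If `T` maps the integer lattice into itself, then for points `p z` with `T (p z) = z` and
disjoint translates `p z + P`, the volume of their union modulo the integer lattice is the index
of the image lattice times the volume of `P`. -/
theorem volume_iUnion_translate_inter_unitCube
    (T : EuclideanSpace ℝ (Fin 2) →ₗ[ℝ] EuclideanSpace ℝ (Fin 2)) (hT : Function.Injective T)
    (κ : (Fin 2 → ℤ) →+ (Fin 2 → ℤ)) (hκ : ∀ k, T (intVec k) = intVec (κ k))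
    (p : (Fin 2 → ℤ) → EuclideanSpace ℝ (Fin 2)) (hp : ∀ z, T (p z) = intVec z)
    {P : Set (EuclideanSpace ℝ (Fin 2))} (hP : MeasurableSet P)
    (hdisj : Pairwise (Function.onFun Disjoint fun z => (fun x => x - p z) ⁻¹' P)) :
    volume ((⋃ z, (fun x => x - p z) ⁻¹' P) ∩ unitCube)
      = ∑' _ : (Fin 2 → ℤ) ⧸ κ.range, volume P := by
  have hinj : Function.Injective κ := by
    intro k l h
    have h2 : intVec k = intVec l := hT (by rw [hκ, hκ, h])
    ext i
    have := congrArg (fun x => x i) h2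
    simpa [intVec_apply] using this
  have hmeas : ∀ z, MeasurableSet ((fun x => x - p z) ⁻¹' P) := fun z =>
    hP.preimage (by fun_prop)
  rw [Set.iUnion_inter, measure_iUnion
    (fun i j hij => (hdisj hij).mono Set.inter_subset_left Set.inter_subset_left)
    (fun z => (hmeas z).inter measurableSet_unitCube)]
  let e : ((Fin 2 → ℤ) ⧸ κ.range) × (Fin 2 → ℤ) ≃ (Fin 2 → ℤ) :=
    Equiv.ofBijective (fun x => x.1.out + κ x.2) (by
      constructor
      · rintro ⟨q, k⟩ ⟨q', k'⟩ h
        have hq : q = q' := by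
          rw [← QuotientAddGroup.out_eq' q, ← QuotientAddGroup.out_eq' q']
          simpa using congrArg (fun x : Fin 2 → ℤ => (x : (Fin 2 → ℤ) ⧸ κ.range)) h
        subst hq
        exact congrArg (Prod.mk q) (hinj (add_left_cancel h))
      · intro z
        obtain ⟨⟨_, k, rfl⟩, hk⟩ := QuotientAddGroup.mk_out_eq_add κ.range z
        exact ⟨⟨z, -k⟩, by simp [hk]⟩)
  have he : ∀ q k, e (q, k) = q.out + κ k := fun _ _ => rfl
  have hpe : ∀ q k, p (e (q, k)) = p q.out + intVec k := by
    intro q k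
    apply hT
    rw [hp, map_add, hp, hκ, he, intVec_add]
  rw [← e.tsum_eq, ENNReal.tsum_prod']
  refine tsum_congr fun q => ?_
  rw [← measure_preimage_add_right volume (-p q.out) P, ← tsum_volume_translate_inter_unitCube
    (hP.preimage (by fun_prop))]
  refine tsum_congr fun k => ?_
  congr 2
  ext x
  simp only [Set.mem_preimage, hpe]
  rw [show x - (p q.out + intVec k) = x - intVec k + -p q.out by abel]

theorem volume_iUnion_translate_inter_unitCube_eq_det
    (T : EuclideanSpace ℝ (Fin 2) →ₗ[ℝ] EuclideanSpace ℝ (Fin 2)) (hT : LinearMap.det T ≠ 0)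
    (κ : (Fin 2 → ℤ) →+ (Fin 2 → ℤ)) (hκ : ∀ k, T (intVec k) = intVec (κ k))
    (p : (Fin 2 → ℤ) → EuclideanSpace ℝ (Fin 2)) (hp : ∀ z, T (p z) = intVec z)
    {P : Set (EuclideanSpace ℝ (Fin 2))} (hP : MeasurableSet P)
    (hdisj : Pairwise (Function.onFun Disjoint fun z => (fun x => x - p z) ⁻¹' P)) :
    volume ((⋃ z, (fun x => x - p z) ⁻¹' P) ∩ unitCube)
      = ENNReal.ofReal |LinearMap.det T| * volume P := by
  have hinj : Function.Injective T := (LinearMap.equivOfDetNeZero T hT).injective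
  have hTm : Measurable T := (LinearMap.continuous_of_finiteDimensional T).measurable
  have hpre : ∀ z, (fun x => x - p z) ⁻¹' (T ⁻¹' unitCube)
      = {x | z = fun i => ⌊T x i⌋} := by
    intro z
    ext x
    rw [Set.mem_preimage, Set.mem_preimage, map_sub, hp, sub_intVec_mem_unitCube_iff]
    rfl
  have h1 := volume_iUnion_translate_inter_unitCube T hinj κ hκ p hp
    (measurableSet_unitCube.preimage hTm) (by
      intro z w hzw
      rw [Function.onFun, hpre, hpre, Set.disjoint_left]
      intro x hx hx'
      exact hzw (Eq.trans hx (Eq.symm hx')))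
  have huniv : (⋃ z, (fun x => x - p z) ⁻¹' (T ⁻¹' unitCube)) = Set.univ := by
    simp_rw [hpre]
    ext x
    simp
  rw [huniv, Set.univ_inter, volume_unitCube, Measure.addHaar_preimage_linearMap _ hT,
    volume_unitCube, mul_one, ENNReal.tsum_const, abs_inv] at h1
  rw [volume_iUnion_translate_inter_unitCube T hinj κ hκ p hp hP hdisj, ENNReal.tsum_const]
  congr 1
  have hpos : 0 < |LinearMap.det T| := abs_pos.2 hT
  rw [ENNReal.ofReal_inv_of_pos hpos, ← div_eq_mul_inv, eq_comm] at h1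
  have := (ENNReal.div_eq_one_iff (by simpa using hpos) ENNReal.ofReal_ne_top).1 h1
  exact this

/-- Bounded gaps in the solutions of an inhomogeneous Diophantine inequality. -/
theorem Irrational.exists_bounded_gap {γ : ℝ} (hγ : Irrational γ) {δ : ℝ} (hδ : 0 < δ) :
    ∃ N : ℕ, 0 < N ∧ ∀ (a₀ : ℤ) (s : ℝ), ∃ a b : ℤ,
      a₀ ≤ a ∧ a < a₀ + N ∧ |b - γ * a - s| ≤ δ := by
  obtain ⟨m, hm⟩ := exists_nat_one_div_lt hδ
  obtain ⟨p, q, hq, -, hpq⟩ := Real.exists_int_int_abs_mul_sub_le γ (n := m + 1) (by omega)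
  set θ : ℝ := q * γ - p with hθ
  have hθ0 : θ ≠ 0 := by
    intro h
    have h2 : γ * q = p := by rw [hθ] at h; linarith
    exact (hγ.mul_intCast hq.ne').ne_int p h2
  have hθδ : |θ| ≤ δ := by
    refine hpq.trans (le_trans ?_ hm.le)
    push_cast
    gcongr
    linarith
  have hθpos : 0 < |θ| := abs_pos.2 hθ0
  refine ⟨q.toNat * (⌊1 / |θ|⌋₊ + 1), Nat.mul_pos (by omega) (by omega), fun a₀ s => ?_⟩
  obtain ⟨σ, hσ2, hσθ, hσabs⟩ :
      ∃ σ : ℤ, (σ : ℝ) * σ = 1 ∧ θ = σ * |θ| ∧ |(σ : ℝ)| = 1 := by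
    rcases lt_or_gt_of_ne hθ0 with h | h
    · exact ⟨-1, by simp [abs_of_neg h]⟩
    · exact ⟨1, by simp [abs_of_pos h]⟩
  set y : ℝ := σ * (-γ * a₀ - s) with hy
  set f : ℝ := Int.fract y with hf
  have hf0 : 0 ≤ f := Int.fract_nonneg y
  have hf1 : f < 1 := Int.fract_lt_one y
  set j : ℕ := ⌊f / |θ|⌋₊ with hj
  have hjle : (j : ℝ) ≤ f / |θ| := Nat.floor_le (by positivity)
  have hjlt : f / |θ| < j + 1 := Nat.lt_floor_add_one _
  have hjN : j < ⌊1 / |θ|⌋₊ + 1 :=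
    Nat.lt_succ_of_le (Nat.floor_le_floor (by gcongr))
  refine ⟨a₀ + j * q, -σ * ⌊y⌋ + j * p, by nlinarith [Int.natCast_nonneg j], ?_, ?_⟩
  · push_cast
    rw [Int.toNat_of_nonneg hq.le]
    have : (j : ℤ) < (⌊1 / |θ|⌋₊ : ℤ) + 1 := by exact_mod_cast hjN
    nlinarith
  · have hfy : f = y - ⌊y⌋ := rfl
    have hval : ((-σ * ⌊y⌋ + j * p : ℤ) : ℝ) - γ * ((a₀ + j * q : ℤ) : ℝ) - s
        = σ * (f - j * |θ|) := by
      have e1 : (σ : ℝ) * y = -γ * a₀ - s := by rw [hy, ← mul_assoc, hσ2, one_mul]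
      have e2 : (σ : ℝ) * |θ| = q * γ - p := by rw [← hσθ]
      rw [hfy]
      push_cast
      linear_combination (-1 : ℝ) * e1 + (j : ℝ) * e2
    rw [hval, abs_mul, hσabs, one_mul]
    rw [le_div_iff₀ hθpos] at hjle
    rw [div_lt_iff₀ hθpos] at hjlt
    rw [abs_le]
    constructor <;> nlinarith

theorem det_toEuclideanLin (M : Matrix (Fin 2) (Fin 2) ℝ) :
    LinearMap.det (Matrix.toEuclideanLin M) = M.det := by
  rw [Matrix.toEuclideanLin, Matrix.toLpLin_eq_toLin, LinearMap.det_toLin]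

theorem det_toEuclideanLin_eq_mul {M : Matrix (Fin 2) (Fin 2) ℝ} {γ β a b : ℝ} (hne : γ ≠ β)
    (hγ : M.mulVec ![1, γ] = a • ![1, γ]) (hβ : M.mulVec ![1, β] = b • ![1, β]) :
    LinearMap.det (Matrix.toEuclideanLin M) = a * b := by
  rw [det_toEuclideanLin, Matrix.det_fin_two]
  have e1 := congrFun hγ 0
  have e2 := congrFun hγ 1
  have e3 := congrFun hβ 0
  have e4 := congrFun hβ 1
  simp [Matrix.mulVec, dotProduct, Fin.sum_univ_two] at e1 e2 e3 e4
  refine mul_right_cancel₀ (sub_ne_zero.2 hne.symm) ?_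
  rw [← e1] at e2
  rw [← e3] at e4
  rw [← e1, ← e3]
  linear_combination (M 0 0 + M 0 1 * γ) * e4 - (M 0 0 + M 0 1 * β) * e2

theorem pow_mulVec_of_mulVec_eq_smul {A : Matrix (Fin 2) (Fin 2) ℝ} {v : Fin 2 → ℝ} {l : ℝ}
    (h : A.mulVec v = l • v) (n : ℕ) : (A ^ n).mulVec v = l ^ n • v := by
  induction n with
  | zero => simp
  | succ n ih => rw [pow_succ, ← Matrix.mulVec_mulVec, h, Matrix.mulVec_smul, ih, smul_smul,
      pow_succ, mul_comm]

theorem inscribedPar_eq_preimage (l₁ l₂ γ β τ : ℝ) (n : ℕ) (p : EuclideanSpace ℝ (Fin 2)) :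
    inscribedPar l₁ l₂ γ β τ n p = (fun x => x - p) ⁻¹' inscribedPar l₁ l₂ γ β τ n 0 := by
  ext x
  simp only [inscribedPar, Set.mem_preimage, Set.mem_ofPred_eq, zero_add, sub_eq_iff_eq_add',
    add_assoc]

theorem inscribedPar_zero_eq_image (l₁ l₂ γ β τ : ℝ) (n : ℕ) :
    inscribedPar l₁ l₂ γ β τ n 0 =
      Matrix.toEuclideanLin !![1 / √(1 + γ ^ 2), 1 / √(1 + β ^ 2);
        γ / √(1 + γ ^ 2), β / √(1 + β ^ 2)] ''
      ((WithLp.ofLp : EuclideanSpace ℝ (Fin 2) → Fin 2 → ℝ) ⁻¹'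
        (Set.univ.pi ![Set.Icc (-(Real.exp (-τ * n) / |l₂ ^ n - 1| / 2))
          (Real.exp (-τ * n) / |l₂ ^ n - 1| / 2),
          Set.Icc (-(Real.exp (-τ * n) / |1 - l₁ ^ n| / 2))
          (Real.exp (-τ * n) / |1 - l₁ ^ n| / 2)])) := by
  have key : ∀ y : EuclideanSpace ℝ (Fin 2),
      Matrix.toEuclideanLin !![1 / √(1 + γ ^ 2), 1 / √(1 + β ^ 2);
        γ / √(1 + γ ^ 2), β / √(1 + β ^ 2)] y
      = (0 : EuclideanSpace ℝ (Fin 2)) + (y 0 / √(1 + γ ^ 2)) • eigVec γ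
        + (y 1 / √(1 + β ^ 2)) • eigVec β := by
    intro y
    ext i
    fin_cases i <;> simp [Matrix.toEuclideanLin, eigVec, Matrix.mulVec, dotProduct,
      Fin.sum_univ_two] <;> ring
  ext x
  simp only [Set.mem_image, key]
  constructor
  · rintro ⟨t, s, ht, hs, rfl⟩
    refine ⟨WithLp.toLp 2 ![t, s], ?_, rfl⟩
    rw [Set.mem_preimage, Set.mem_univ_pi, Fin.forall_fin_two]
    exact ⟨abs_le.1 ht, abs_le.1 hs⟩
  · rintro ⟨y, hy, rfl⟩
    have := (Set.mem_univ_pi.1 (Set.mem_preimage.1 hy))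
    exact ⟨y 0, y 1, abs_le.2 (this 0), abs_le.2 (this 1), rfl⟩

theorem isCompact_inscribedPar_zero (l₁ l₂ γ β τ : ℝ) (n : ℕ) :
    IsCompact (inscribedPar l₁ l₂ γ β τ n 0) := by
  rw [inscribedPar_zero_eq_image]
  refine IsCompact.image ?_ (LinearMap.continuous_of_finiteDimensional _)
  refine (PiLp.homeomorph 2 fun _ : Fin 2 => ℝ).isCompact_preimage.2 (isCompact_univ_pi ?_)
  intro i
  fin_cases i <;> exact isCompact_Icc

theorem volume_inscribedPar_zero (l₁ l₂ γ β τ : ℝ) (n : ℕ) :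
    volume (inscribedPar l₁ l₂ γ β τ n 0) = ENNReal.ofReal
      (|γ - β| / √((1 + β ^ 2) * (1 + γ ^ 2)) *
        (Real.exp (-τ * n) / |l₂ ^ n - 1| * (Real.exp (-τ * n) / |1 - l₁ ^ n|))) := by
  have hs : MeasurableSet (Set.univ.pi ![Set.Icc (-(Real.exp (-τ * n) / |l₂ ^ n - 1| / 2))
          (Real.exp (-τ * n) / |l₂ ^ n - 1| / 2),
          Set.Icc (-(Real.exp (-τ * n) / |1 - l₁ ^ n| / 2))
          (Real.exp (-τ * n) / |1 - l₁ ^ n| / 2)]) := by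
    refine MeasurableSet.univ_pi fun i => ?_
    fin_cases i <;> exact measurableSet_Icc
  rw [inscribedPar_zero_eq_image, Measure.addHaar_image_linearMap,
    (PiLp.volume_preserving_ofLp (Fin 2)).measure_preimage hs.nullMeasurableSet, volume_pi_pi,
    det_toEuclideanLin, Matrix.det_fin_two,
    Fin.prod_univ_two]
  simp only [Matrix.cons_val_zero, Matrix.cons_val_one, Real.volume_Icc, sub_neg_eq_add, add_halves]
  rw [← ENNReal.ofReal_mul (by positivity), ← ENNReal.ofReal_mul (by positivity)]
  congr 1
  have h1 : 0 < √(1 + γ ^ 2) := by positivity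
  have h2 : 0 < √(1 + β ^ 2) := by positivity
  have e : 1 / √(1 + γ ^ 2) * (β / √(1 + β ^ 2)) - 1 / √(1 + β ^ 2) * (γ / √(1 + γ ^ 2))
      = (β - γ) / (√(1 + β ^ 2) * √(1 + γ ^ 2)) := by
    field_simp
  simp only [Matrix.of_apply, Matrix.cons_val_zero, Matrix.cons_val_one, Matrix.cons_val',
    Matrix.cons_val_fin_one]
  rw [e, abs_div, abs_sub_comm β γ, abs_of_pos (mul_pos h2 h1), Real.sqrt_mul (by positivity)]

theorem abs_div_sqrt_mul_eigVec_le (t γ : ℝ) (i : Fin 2) :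
    |t / √(1 + γ ^ 2) * eigVec γ i| ≤ |t| := by
  have h1 : 0 < √(1 + γ ^ 2) := by positivity
  have h2 : |eigVec γ i| ≤ √(1 + γ ^ 2) := by
    refine Real.abs_le_sqrt ?_
    fin_cases i <;> simp [eigVec]
    positivity
  rw [abs_mul, abs_div, abs_of_pos h1, div_mul_eq_mul_div, div_le_iff₀ h1]
  gcongr

/-- The image of the parallelogram under a linear map diagonal in its directions is small. -/
theorem abs_apply_le_of_mem_inscribedPar_zero {l₁ l₂ γ β τ : ℝ} {n : ℕ}
    (T : EuclideanSpace ℝ (Fin 2) →ₗ[ℝ] EuclideanSpace ℝ (Fin 2))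
    (hγ : T (eigVec γ) = (l₂ ^ n - 1) • eigVec γ) (hβ : T (eigVec β) = (l₁ ^ n - 1) • eigVec β)
    (h₂ : 0 < |l₂ ^ n - 1|) (h₁ : 0 < |1 - l₁ ^ n|)
    {x : EuclideanSpace ℝ (Fin 2)} (hx : x ∈ inscribedPar l₁ l₂ γ β τ n 0) (i : Fin 2) :
    |T x i| ≤ Real.exp (-τ * n) := by
  obtain ⟨t, s, ht, hs, rfl⟩ := hx
  have e : T (0 + (t / √(1 + γ ^ 2)) • eigVec γ + (s / √(1 + β ^ 2)) • eigVec β) i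
      = (t * (l₂ ^ n - 1)) / √(1 + γ ^ 2) * eigVec γ i
        + (s * (l₁ ^ n - 1)) / √(1 + β ^ 2) * eigVec β i := by
    rw [zero_add, map_add, map_smul, map_smul, hγ, hβ]
    simp only [PiLp.add_apply, PiLp.smul_apply, smul_eq_mul]
    ring
  rw [e]
  refine (abs_add_le _ _).trans ((add_le_add (abs_div_sqrt_mul_eigVec_le _ _ _)
    (abs_div_sqrt_mul_eigVec_le _ _ _)).trans ?_)
  rw [abs_mul, abs_mul, abs_sub_comm (l₁ ^ n)]
  rw [div_right_comm, le_div_iff₀ h₂] at ht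
  rw [div_right_comm, le_div_iff₀ h₁] at hs
  linarith

/-- Translates of the parallelogram by distinct periodic points are disjoint. -/
theorem pairwise_disjoint_translate_inscribedPar {l₁ l₂ γ β τ : ℝ} {n : ℕ}
    (T : EuclideanSpace ℝ (Fin 2) →ₗ[ℝ] EuclideanSpace ℝ (Fin 2))
    (hγ : T (eigVec γ) = (l₂ ^ n - 1) • eigVec γ) (hβ : T (eigVec β) = (l₁ ^ n - 1) • eigVec β)
    (h₂ : 0 < |l₂ ^ n - 1|) (h₁ : 0 < |1 - l₁ ^ n|) (hε : Real.exp (-τ * n) < 1 / 2)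
    (p : (Fin 2 → ℤ) → EuclideanSpace ℝ (Fin 2)) (hp : ∀ z, T (p z) = intVec z) :
    Pairwise (Function.onFun Disjoint fun z =>
      (fun x => x - p z) ⁻¹' inscribedPar l₁ l₂ γ β τ n 0) := by
  intro z w hzw
  rw [Function.onFun, Set.disjoint_left]
  intro x hx hx'
  refine hzw (funext fun i => ?_)
  have e1 := abs_apply_le_of_mem_inscribedPar_zero T hγ hβ h₂ h₁ hx i
  have e2 := abs_apply_le_of_mem_inscribedPar_zero T hγ hβ h₂ h₁ hx' i
  rw [map_sub, hp, PiLp.sub_apply, intVec_apply] at e1 e2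
  rw [abs_le] at e1 e2
  have f1 : (z i : ℝ) < w i + 1 := by linarith
  have f2 : (w i : ℝ) < z i + 1 := by linarith
  have g1 : z i < w i + 1 := by exact_mod_cast f1
  have g2 : w i < z i + 1 := by exact_mod_cast f2
  omega

/-- The data of the map `Aⁿ - 1` used below: its eigenvectors, its action on the integer lattice,
and the parametrization of the periodic points by integer vectors. -/
theorem exists_periodicLift_parametrization (A : Matrix (Fin 2) (Fin 2) ℤ) {l₁ l₂ γ β : ℝ}
    (h0 : 0 < l₁) (h1 : l₁ < 1) (h2 : 1 < l₂) (hne : γ ≠ β)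
    (hγ : (A.map (Int.cast : ℤ → ℝ)).mulVec ![1, γ] = l₂ • ![1, γ])
    (hβ : (A.map (Int.cast : ℤ → ℝ)).mulVec ![1, β] = l₁ • ![1, β])
    (τ : ℝ) {n : ℕ} (hn : 1 ≤ n) :
    ∃ (T : EuclideanSpace ℝ (Fin 2) →ₗ[ℝ] EuclideanSpace ℝ (Fin 2))
      (κ : (Fin 2 → ℤ) →+ (Fin 2 → ℤ)) (p : (Fin 2 → ℤ) → EuclideanSpace ℝ (Fin 2)),
      LinearMap.det T = (l₂ ^ n - 1) * (l₁ ^ n - 1) ∧ LinearMap.det T ≠ 0 ∧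
      T (eigVec γ) = (l₂ ^ n - 1) • eigVec γ ∧ T (eigVec β) = (l₁ ^ n - 1) • eigVec β ∧
      (∀ k, T (intVec k) = intVec (κ k)) ∧ (∀ z, T (p z) = intVec z) ∧
      EnSet A l₁ l₂ γ β τ n = ⋃ z, (fun x => x - p z) ⁻¹' inscribedPar l₁ l₂ γ β τ n 0 := by
  set M : Matrix (Fin 2) (Fin 2) ℝ := (A ^ n).map (Int.cast : ℤ → ℝ) - 1 with hM
  have hMA : M = (A.map (Int.cast : ℤ → ℝ)) ^ n - 1 := by
    rw [hM]
    congr 1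
    exact map_pow (Int.castRingHom ℝ).mapMatrix A n
  have hMK : M = (A ^ n - 1).map (Int.cast : ℤ → ℝ) := by
    rw [hM]
    have := map_sub (Int.castRingHom ℝ).mapMatrix (A ^ n) 1
    rw [map_one] at this
    exact this.symm
  have hMγ : M.mulVec ![1, γ] = (l₂ ^ n - 1) • ![1, γ] := by
    rw [hMA, Matrix.sub_mulVec, pow_mulVec_of_mulVec_eq_smul hγ, Matrix.one_mulVec, sub_smul,
      one_smul]
  have hMβ : M.mulVec ![1, β] = (l₁ ^ n - 1) • ![1, β] := by
    rw [hMA, Matrix.sub_mulVec, pow_mulVec_of_mulVec_eq_smul hβ, Matrix.one_mulVec, sub_smul,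
      one_smul]
  have hdet := det_toEuclideanLin_eq_mul hne hMγ hMβ
  have hdet0 : LinearMap.det (Matrix.toEuclideanLin M) ≠ 0 := by
    rw [hdet]
    have := one_lt_pow₀ h2 (by omega : n ≠ 0)
    have := pow_lt_one₀ h0.le h1 (by omega : n ≠ 0)
    exact mul_ne_zero (by linarith) (by linarith)
  let e := LinearMap.equivOfDetNeZero _ hdet0
  have he : ∀ y, Matrix.toEuclideanLin M (e.symm y) = y := fun y => e.apply_symm_apply y
  refine ⟨Matrix.toEuclideanLin M, (A ^ n - 1).mulVecLin.toAddMonoidHom,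
    fun z => e.symm (intVec z), hdet, hdet0, ?_, ?_, ?_, fun z => he _, ?_⟩
  · ext i
    exact congrFun hMγ i
  · ext i
    exact congrFun hMβ i
  · intro k
    rw [hMK]
    ext i
    fin_cases i <;> simp [Matrix.toEuclideanLin, intVec] <;> ring
  · rw [EnSet]
    ext x
    simp only [Set.mem_iUnion, periodicLift, Set.mem_ofPred_eq, exists_prop,
      ← inscribedPar_eq_preimage]
    constructor
    · rintro ⟨q, ⟨z, hz⟩, hx⟩
      refine ⟨z, ?_⟩
      rw [← hz]
      rwa [show e.symm (Matrix.toEuclideanLin M q) = q from e.symm_apply_apply q]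
    · rintro ⟨z, hx⟩
      exact ⟨_, ⟨z, he _⟩, hx⟩

theorem volume_EnSet_inter_unitCube (A : Matrix (Fin 2) (Fin 2) ℤ) {l₁ l₂ γ β : ℝ}
    (h0 : 0 < l₁) (h1 : l₁ < 1) (h2 : 1 < l₂) (hne : γ ≠ β)
    (hγ : (A.map (Int.cast : ℤ → ℝ)).mulVec ![1, γ] = l₂ • ![1, γ])
    (hβ : (A.map (Int.cast : ℤ → ℝ)).mulVec ![1, β] = l₁ • ![1, β])
    {τ : ℝ} {n : ℕ} (hn : 1 ≤ n) (hε : Real.exp (-τ * n) < 1 / 2) :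
    volume (EnSet A l₁ l₂ γ β τ n ∩ unitCube) =
      ENNReal.ofReal ((l₂ ^ n - 1) * (1 - l₁ ^ n)) * volume (inscribedPar l₁ l₂ γ β τ n 0) := by
  obtain ⟨T, κ, p, hdet, hdet0, hTγ, hTβ, hκ, hp, hE⟩ :=
    exists_periodicLift_parametrization A h0 h1 h2 hne hγ hβ τ hn
  have g2 : 0 < l₂ ^ n - 1 := sub_pos.2 (one_lt_pow₀ h2 (by omega))
  have g1 : 0 < 1 - l₁ ^ n := sub_pos.2 (pow_lt_one₀ h0.le h1 (by omega))
  rw [hE, volume_iUnion_translate_inter_unitCube_eq_det T hdet0 κ hκ p hp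
    (isCompact_inscribedPar_zero _ _ _ _ _ _).measurableSet
    (pairwise_disjoint_translate_inscribedPar T hTγ hTβ (abs_pos.2 g2.ne') (abs_pos.2 g1.ne')
      hε p hp), hdet, abs_mul, abs_sub_comm (l₁ ^ n), abs_of_pos g1, abs_of_pos g2]

theorem volume_EnSet_inter_unitCube_eq_exp (A : Matrix (Fin 2) (Fin 2) ℤ) {l₁ l₂ γ β : ℝ}
    (h0 : 0 < l₁) (h1 : l₁ < 1) (h2 : 1 < l₂) (hne : γ ≠ β)
    (hγ : (A.map (Int.cast : ℤ → ℝ)).mulVec ![1, γ] = l₂ • ![1, γ])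
    (hβ : (A.map (Int.cast : ℤ → ℝ)).mulVec ![1, β] = l₁ • ![1, β])
    {τ : ℝ} {n : ℕ} (hn : 1 ≤ n) (hε : Real.exp (-τ * n) < 1 / 2) :
    volume (EnSet A l₁ l₂ γ β τ n ∩ unitCube) =
      ENNReal.ofReal (|γ - β| / √((1 + β ^ 2) * (1 + γ ^ 2)) * Real.exp (-2 * n * τ)) := by
  have g2 : 0 < l₂ ^ n - 1 := sub_pos.2 (one_lt_pow₀ h2 (by omega))
  have g1 : 0 < 1 - l₁ ^ n := sub_pos.2 (pow_lt_one₀ h0.le h1 (by omega))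
  rw [volume_EnSet_inter_unitCube A h0 h1 h2 hne hγ hβ hn hε, volume_inscribedPar_zero,
    ← ENNReal.ofReal_mul (by positivity), abs_of_pos g1, abs_of_pos g2]
  congr 1
  rw [show -2 * (n : ℝ) * τ = -τ * n + -τ * n by ring, Real.exp_add]
  field_simp

theorem volume_inter_ball_le_of_periodic (x : EuclideanSpace ℝ (Fin 2)) (r : ℝ) :
    ∃ K : ℝ≥0∞, K ≠ ⊤ ∧ ∀ E : Set (EuclideanSpace ℝ (Fin 2)),
      (∀ (k : Fin 2 → ℤ) (y : EuclideanSpace ℝ (Fin 2)), y + intVec k ∈ E → y ∈ E) →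
      volume (E ∩ Metric.ball x r) ≤ K * volume (E ∩ unitCube) := by
  let F : Finset (Fin 2 → ℤ) := Finset.Icc (fun i => ⌊x i - r⌋) (fun i => ⌊x i + r⌋)
  refine ⟨F.card, ENNReal.natCast_ne_top _, fun E hE => ?_⟩
  have hsub : E ∩ Metric.ball x r ⊆ ⋃ k ∈ F, E ∩ (fun y => y - intVec k) ⁻¹' unitCube := by
    rintro y ⟨hyE, hy⟩
    have hyi : ∀ i, |y i - x i| < r := fun i =>
      ((PiLp.norm_apply_le (y - x) i).trans_lt (mem_ball_iff_norm.1 hy))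
    simp only [Set.mem_iUnion]
    refine ⟨fun i => ⌊y i⌋, ?_, hyE, (sub_intVec_mem_unitCube_iff _ _).2 rfl⟩
    refine Finset.mem_Icc.2 ⟨fun i => Int.floor_le_floor ?_, fun i => Int.floor_le_floor ?_⟩ <;>
    · have := abs_lt.1 (hyi i)
      linarith
  refine (measure_mono hsub).trans ((measure_biUnion_finset_le _ _).trans ?_)
  rw [← nsmul_eq_mul]
  refine Finset.sum_le_card_nsmul _ _ _ fun k _ => ?_
  rw [← measure_preimage_add_right volume (intVec k)
    (E ∩ (fun y => y - intVec k) ⁻¹' unitCube)]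
  refine measure_mono ?_
  rintro y ⟨h1, h2⟩
  refine ⟨hE k y h1, ?_⟩
  simpa using h2

/-- Coordinates of an integer vector in the basis of eigenvectors. -/
theorem intVec_eq_smul_eigVec_add {γ β : ℝ} (hne : γ ≠ β) (a b : ℤ) :
    intVec ![a, b] = ((a : ℝ) - (b - γ * a) / (β - γ)) • eigVec γ
      + ((b - γ * a) / (β - γ)) • eigVec β := by
  have h : β - γ ≠ 0 := sub_ne_zero.2 hne.symm
  ext i
  fin_cases i
  · simp [intVec, eigVec]
  · simp [intVec, eigVec]
    field_simp
    ring

theorem exists_eq_smul_eigVec_add {γ β : ℝ} (hne : γ ≠ β) (x : EuclideanSpace ℝ (Fin 2)) :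
    ∃ t s : ℝ, x = t • eigVec γ + s • eigVec β := by
  have h : β - γ ≠ 0 := sub_ne_zero.2 hne.symm
  refine ⟨x 0 - (x 1 - γ * x 0) / (β - γ), (x 1 - γ * x 0) / (β - γ), ?_⟩
  ext i
  fin_cases i
  · simp [eigVec]
  · simp [eigVec]
    field_simp
    ring

/-- A strip in the direction `(1, γ)` contains, with a positive density, integer points. -/
theorem exists_injective_intVec_near_line {γ β : ℝ} (hγ : Irrational γ) (hne : γ ≠ β) {δ : ℝ}
    (hδ : 0 < δ) :
    ∃ N : ℕ, 0 < N ∧ ∀ (t₀ s₀ : ℝ) (J : ℕ), ∃ z : Fin J → Fin 2 → ℤ, Function.Injective z ∧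
      ∀ j, ∃ t s : ℝ, intVec (z j) = t • eigVec γ + s • eigVec β ∧ |s - s₀| ≤ δ ∧
        t₀ - δ ≤ t ∧ t ≤ t₀ + J * N + 1 + δ := by
  have hb : 0 < |β - γ| := abs_pos.2 (sub_ne_zero.2 hne.symm)
  obtain ⟨N, hN, hgap⟩ := hγ.exists_bounded_gap (mul_pos hδ hb)
  refine ⟨N, hN, fun t₀ s₀ J => ?_⟩
  choose a b ha ha' hab using fun j : Fin J => hgap (⌈t₀ + s₀⌉ + j * N) ((β - γ) * s₀)
  refine ⟨fun j => ![a j, b j], ?_, fun j => ⟨_, _, intVec_eq_smul_eigVec_add hne _ _, ?_⟩⟩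
  · intro i j hij
    have h : a i = a j := congrFun hij 0
    have key : ∀ i j : Fin J, a i = a j → (i : ℕ) ≤ j := by
      intro i j h
      by_contra hlt
      have h1 : ((j : ℕ) : ℤ) + 1 ≤ (i : ℕ) := by omega
      have h2 := ha i
      have h3 := ha' j
      nlinarith
    exact Fin.ext (le_antisymm (key i j h) (key j i h.symm))
  · have hs : |(b j - γ * a j) / (β - γ) - s₀| ≤ δ := by
      have : (b j - γ * a j) / (β - γ) - s₀ = (b j - γ * a j - (β - γ) * s₀) / (β - γ) := by
        field_simp [sub_ne_zero.2 hne.symm]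
      rw [this, abs_div, div_le_iff₀ hb]
      exact hab j
    have hs' := abs_le.1 hs
    have hj : ((j : ℕ) : ℤ) + 1 ≤ J := by exact_mod_cast j.2
    have a1 : ⌈t₀ + s₀⌉ ≤ a j := le_trans (by nlinarith [Int.natCast_nonneg (j : ℕ)]) (ha j)
    have a2 : a j ≤ ⌈t₀ + s₀⌉ + J * N := by nlinarith [ha' j]
    have b1 : t₀ + s₀ ≤ a j := Int.ceil_le.1 a1
    have b2 : (a j : ℝ) ≤ ⌈t₀ + s₀⌉ + J * N := by exact_mod_cast a2
    have b3 := Int.ceil_lt_add_one (t₀ + s₀)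
    exact ⟨hs, by linarith, by linarith⟩

theorem norm_smul_eigVec_add_le (γ β t s ρ : ℝ) (ht : |t| ≤ ρ) (hs : |s| ≤ ρ) :
    ‖t • eigVec γ + s • eigVec β‖ ≤ ρ * (‖eigVec γ‖ + ‖eigVec β‖) := by
  refine (norm_add_le _ _).trans ?_
  rw [norm_smul, norm_smul, Real.norm_eq_abs, Real.norm_eq_abs, mul_add]
  gcongr

theorem abs_div_sqrt_one_add_sq_le (t γ : ℝ) : |t / √(1 + γ ^ 2)| ≤ |t| := by
  rw [abs_div, abs_of_nonneg (Real.sqrt_nonneg _)]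
  exact div_le_self (abs_nonneg _) (Real.one_le_sqrt.2 (by nlinarith))

/-- Lower density of `E_n` in a ball. -/
theorem exists_eventually_mul_volume_le (A : Matrix (Fin 2) (Fin 2) ℤ) {l₁ l₂ γ β : ℝ}
    (h0 : 0 < l₁) (h1 : l₁ < 1) (h2 : 1 < l₂) (hne : γ ≠ β)
    (hγ : (A.map (Int.cast : ℤ → ℝ)).mulVec ![1, γ] = l₂ • ![1, γ])
    (hβ : (A.map (Int.cast : ℤ → ℝ)).mulVec ![1, β] = l₁ • ![1, β])
    (hγirr : Irrational γ) {τ : ℝ} (hτ : 0 < τ) (x : EuclideanSpace ℝ (Fin 2)) {r : ℝ}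
    (hr : 0 < r) :
    ∃ c : ℝ, 0 < c ∧ ∀ᶠ n : ℕ in atTop,
      ENNReal.ofReal c * volume (EnSet A l₁ l₂ γ β τ n ∩ unitCube)
        ≤ volume (EnSet A l₁ l₂ γ β τ n ∩ Metric.ball x r) := by
  obtain ⟨tx, sx, hx⟩ := exists_eq_smul_eigVec_add hne x
  set w := ‖eigVec γ‖ + ‖eigVec β‖ with hw
  obtain ⟨ρ, hρ, hρr⟩ : ∃ ρ : ℝ, 0 < ρ ∧ 2 * ρ * w < r := by
    refine ⟨r / (2 * (w + 1)), by positivity, ?_⟩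
    have : 0 ≤ w := by positivity
    rw [show 2 * (r / (2 * (w + 1))) * w = r * w / (w + 1) by field_simp, div_lt_iff₀ (by linarith)]
    nlinarith
  have hl : 0 < 1 - l₁ := by linarith
  have hδ : 0 < ρ * (1 - l₁) := mul_pos hρ hl
  set δ := ρ * (1 - l₁) with hδdef
  obtain ⟨N, hN, hpts⟩ := exists_injective_intVec_near_line hγirr hne hδ
  have hN' : (0 : ℝ) < N := by exact_mod_cast hN
  refine ⟨ρ / (2 * N), by positivity, ?_⟩
  have hexp : Tendsto (fun n : ℕ => Real.exp (-τ * n)) atTop (nhds 0) := by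
    refine Real.tendsto_exp_atBot.comp ?_
    exact tendsto_natCast_atTop_atTop.const_mul_atTop_of_neg (by linarith)
  have hpow := tendsto_pow_atTop_atTop_of_one_lt h2
  have hε0 : 0 < min (1 / 2) δ := lt_min (by norm_num) hδ
  filter_upwards [eventually_ge_atTop 1, hexp.eventually (gt_mem_nhds hε0),
    hpow.eventually_ge_atTop (2 + 2 * (1 + 2 * δ + N) / ρ)] with n hn hε hX
  have hε1 : Real.exp (-τ * n) < 1 / 2 := hε.trans_le (min_le_left _ _)
  have hε2 : Real.exp (-τ * n) < δ := hε.trans_le (min_le_right _ _)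
  have hl1n : l₁ ^ n ≤ l₁ := pow_le_of_le_one h0.le h1.le (by omega)
  have hl1n0 : 0 < l₁ ^ n := by positivity
  obtain ⟨X, hXdef⟩ : ∃ X, X = l₂ ^ n - 1 := ⟨_, rfl⟩
  obtain ⟨Y, hYdef⟩ : ∃ Y, Y = 1 - l₁ ^ n := ⟨_, rfl⟩
  have hY1 : 1 - l₁ ≤ Y := by linarith
  have hYle : Y ≤ 1 := by linarith
  have hYpos : 0 < Y := by linarith
  have hX1 : 1 + 2 * (1 + 2 * δ + N) / ρ ≤ X := by linarith
  have hXge1 : 1 ≤ X := le_trans (by have : 0 ≤ 2 * (1 + 2 * δ + N) / ρ := by positivity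
                                     linarith) hX1
  have hXpos : 0 < X := by linarith
  have hXρ : 2 * (1 + 2 * δ + N) ≤ ρ * X := by
    have : 2 * (1 + 2 * δ + N) / ρ ≤ X := by linarith
    rwa [div_le_iff₀ hρ, mul_comm X] at this
  obtain ⟨T, κ, p, -, hdet0, hTγ, hTβ, -, hp, hE⟩ :=
    exists_periodicLift_parametrization A h0 h1 h2 hne hγ hβ τ hn
  have hdisj := pairwise_disjoint_translate_inscribedPar (τ := τ) T hTγ hTβ
    (by rw [← hXdef]; exact abs_pos.2 hXpos.ne') (by rw [← hYdef]; exact abs_pos.2 hYpos.ne')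
    hε1 p hp
  set P := inscribedPar l₁ l₂ γ β τ n 0 with hPdef
  have hPm : MeasurableSet P := (isCompact_inscribedPar_zero _ _ _ _ _ _).measurableSet
  obtain ⟨J, hJ1, hJ2⟩ : ∃ J : ℕ, J * N + 1 + 2 * δ ≤ ρ * X ∧ ρ * X ≤ 2 * N * J := by
    refine ⟨⌊(ρ * X - 1 - 2 * δ) / N⌋₊, ?_, ?_⟩
    · have := Nat.floor_le (a := (ρ * X - 1 - 2 * δ) / N) (div_nonneg (by linarith) hN'.le)
      rw [le_div_iff₀ hN'] at this
      linarith
    · have := Nat.lt_floor_add_one ((ρ * X - 1 - 2 * δ) / N)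
      rw [div_lt_iff₀ hN'] at this
      linarith
  obtain ⟨z, hzinj, hz⟩ := hpts (tx * X) (-(sx * Y)) J
  have hsub : ∀ j, (fun y => y - p (z j)) ⁻¹' P ⊆ EnSet A l₁ l₂ γ β τ n ∩ Metric.ball x r := by
    intro j y hy
    refine ⟨by rw [hE]; exact Set.mem_iUnion.2 ⟨z j, hy⟩, ?_⟩
    obtain ⟨t, s, hzts, hs, ht1, ht2⟩ := hz j
    have hpz : p (z j) = (t / X) • eigVec γ + (s / (-Y)) • eigVec β := by
      apply (LinearMap.equivOfDetNeZero T hdet0).injective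
      change T _ = T _
      rw [hp, hzts, map_add, map_smul, map_smul, hTγ, hTβ, smul_smul, smul_smul, ← hXdef,
        show l₁ ^ n - 1 = -Y by linarith, div_mul_cancel₀ _ hXpos.ne',
        div_mul_cancel₀ _ (neg_ne_zero.2 hYpos.ne')]
    obtain ⟨t', s', ht', hs', hyeq⟩ := hy
    have hyx : y - x = ((t / X - tx) • eigVec γ + (s / (-Y) - sx) • eigVec β)
        + ((t' / √(1 + γ ^ 2)) • eigVec γ + (s' / √(1 + β ^ 2)) • eigVec β) := by
      rw [sub_eq_iff_eq_add.1 hyeq, hpz, hx]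
      module
    have c1 : |t / X - tx| ≤ ρ := by
      rw [show t / X - tx = (t - tx * X) / X by field_simp, abs_div, abs_of_pos hXpos,
        div_le_iff₀ hXpos, abs_le]
      constructor <;> linarith [show 0 ≤ (J : ℝ) * N by positivity]
    have c2 : |s / (-Y) - sx| ≤ ρ := by
      rw [show s / (-Y) - sx = (s - -(sx * Y)) / (-Y) by field_simp; ring, abs_div, abs_neg,
        abs_of_pos hYpos, div_le_iff₀ hYpos]
      exact hs.trans (mul_le_mul_of_nonneg_left hY1 hρ.le)
    have c3 : |t' / √(1 + γ ^ 2)| ≤ ρ := by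
      refine (abs_div_sqrt_one_add_sq_le _ _).trans (ht'.trans ?_)
      rw [← hXdef, abs_of_pos hXpos, div_div, div_le_iff₀ (by positivity)]
      nlinarith
    have c4 : |s' / √(1 + β ^ 2)| ≤ ρ := by
      refine (abs_div_sqrt_one_add_sq_le _ _).trans (hs'.trans ?_)
      rw [← hYdef, abs_of_pos hYpos, div_div, div_le_iff₀ (by positivity)]
      nlinarith
    rw [mem_ball_iff_norm, hyx]
    refine (norm_add_le _ _).trans_lt (lt_of_le_of_lt ?_ hρr)
    have := norm_smul_eigVec_add_le γ β _ _ ρ c1 c2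
    have := norm_smul_eigVec_add_le γ β _ _ ρ c3 c4
    linarith
  have hJP : (J : ℝ≥0∞) * volume P ≤ volume (EnSet A l₁ l₂ γ β τ n ∩ Metric.ball x r) := by
    refine le_trans (le_of_eq ?_) (measure_mono (Set.iUnion_subset hsub))
    rw [measure_iUnion (hdisj.comp_of_injective hzinj)
      (fun j => hPm.preimage (by fun_prop)), tsum_fintype]
    simp only [sub_eq_add_neg, measure_preimage_add_right]
    simp
  refine le_trans ?_ hJP
  rw [volume_EnSet_inter_unitCube A h0 h1 h2 hne hγ hβ hn hε1, ← mul_assoc,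
    ← ENNReal.ofReal_mul (by positivity), ← ENNReal.ofReal_natCast J]
  gcongr
  rw [← hXdef, ← hYdef, div_mul_eq_mul_div, div_le_iff₀ (by positivity)]
  calc ρ * (X * Y) ≤ ρ * (X * 1) := by gcongr
    _ ≤ J * (2 * N) := by linarith

theorem mem_EnSet_of_add_intVec_mem (A : Matrix (Fin 2) (Fin 2) ℤ) {l₁ l₂ γ β : ℝ}
    (h0 : 0 < l₁) (h1 : l₁ < 1) (h2 : 1 < l₂) (hne : γ ≠ β)
    (hγ : (A.map (Int.cast : ℤ → ℝ)).mulVec ![1, γ] = l₂ • ![1, γ])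
    (hβ : (A.map (Int.cast : ℤ → ℝ)).mulVec ![1, β] = l₁ • ![1, β])
    {τ : ℝ} {n : ℕ} (hn : 1 ≤ n) (k : Fin 2 → ℤ) (y : EuclideanSpace ℝ (Fin 2))
    (hy : y + intVec k ∈ EnSet A l₁ l₂ γ β τ n) : y ∈ EnSet A l₁ l₂ γ β τ n := by
  obtain ⟨T, κ, p, -, hdet0, -, -, hκ, hp, hE⟩ :=
    exists_periodicLift_parametrization A h0 h1 h2 hne hγ hβ τ hn
  rw [hE] at hy ⊢
  obtain ⟨z, hz⟩ := Set.mem_iUnion.1 hy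
  refine Set.mem_iUnion.2 ⟨z - κ k, ?_⟩
  have hpz : p z = p (z - κ k) + intVec k := by
    apply (LinearMap.equivOfDetNeZero T hdet0).injective
    change T _ = T _
    rw [map_add, hp, hp, hκ, ← intVec_add, sub_add_cancel]
  rw [Set.mem_preimage, hpz, add_sub_add_right_eq_sub] at hz
  exact hz

/-- `μ(E_n) = (|γ-β|/√((1+β²)(1+γ²))) e^{-2nτ}`, and the normalised measures
`μ_n = μ(E_n)⁻¹ μ|_{E_n}` satisfy, for every ball `B`,
`C⁻¹ ≤ liminf μ_n(B)/μ(B) ≤ limsup μ_n(B)/μ(B) ≤ C` for some `C > 1`. -/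
theorem measure_En_and_ratio (A : Matrix (Fin 2) (Fin 2) ℤ) (l₁ l₂ γ β : ℝ)
    (hsum : l₁ + l₂ = (A.trace : ℝ)) (hprod : l₁ * l₂ = (A.det : ℝ))
    (h0 : 0 < l₁) (h1 : l₁ < 1) (h2 : 1 < l₂)
    (hγ : (A.map (Int.cast : ℤ → ℝ)).mulVec ![1, γ] = l₂ • ![1, γ])
    (hβ : (A.map (Int.cast : ℤ → ℝ)).mulVec ![1, β] = l₁ • ![1, β])
    (hγirr : Irrational γ) (hβirr : Irrational β)
    (τ : ℝ) (hτ : 0 < τ) :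
    (∀ n : ℕ, 1 ≤ n → Real.exp (-(n : ℝ) * τ) < 1 / 2 →
      volume (EnSet A l₁ l₂ γ β τ n ∩ unitCube)
        = ENNReal.ofReal (|γ - β| / Real.sqrt ((1 + β ^ 2) * (1 + γ ^ 2))
            * Real.exp (-2 * n * τ))) ∧
    (∀ (x : EuclideanSpace ℝ (Fin 2)) (r : ℝ), 0 < r →
      ∃ C : ℝ≥0∞, 1 < C ∧ C < ⊤ ∧
        C⁻¹ ≤ liminf (fun n : ℕ =>
            ((volume (EnSet A l₁ l₂ γ β τ n ∩ unitCube))⁻¹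
                • volume.restrict (EnSet A l₁ l₂ γ β τ n)) (Metric.ball x r)
              / volume (Metric.ball x r)) atTop ∧
        limsup (fun n : ℕ =>
            ((volume (EnSet A l₁ l₂ γ β τ n ∩ unitCube))⁻¹
                • volume.restrict (EnSet A l₁ l₂ γ β τ n)) (Metric.ball x r)
              / volume (Metric.ball x r)) atTop ≤ C) := by
  have hne : γ ≠ β := by
    rintro rfl
    have h := congrFun (hγ.symm.trans hβ) 0
    simp at h
    linarith
  have hlt : ∀ {n : ℕ}, Real.exp (-(n : ℝ) * τ) < 1 / 2 → Real.exp (-τ * n) < 1 / 2 := by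
    intro n h
    rwa [neg_mul, mul_comm, ← neg_mul] at h
  refine ⟨fun n hn hε => volume_EnSet_inter_unitCube_eq_exp A h0 h1 h2 hne hγ hβ hn (hlt hε),
    fun x r hr => ?_⟩
  obtain ⟨K, hK, hupper⟩ := volume_inter_ball_le_of_periodic x r
  obtain ⟨c, hc, hlower⟩ :=
    exists_eventually_mul_volume_le A h0 h1 h2 hne hγ hβ hγirr hτ x hr
  set w := volume (Metric.ball x r) with hw
  have hw0 : w ≠ 0 := (Metric.measure_ball_pos volume x hr).ne'
  have hwt : w ≠ ⊤ := measure_ball_lt_top.ne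
  have hratio : ∀ n, ((volume (EnSet A l₁ l₂ γ β τ n ∩ unitCube))⁻¹
      • volume.restrict (EnSet A l₁ l₂ γ β τ n)) (Metric.ball x r) / w
      = volume (EnSet A l₁ l₂ γ β τ n ∩ Metric.ball x r)
        / volume (EnSet A l₁ l₂ γ β τ n ∩ unitCube) / w := by
    intro n
    rw [Measure.smul_apply, Measure.restrict_apply measurableSet_ball, smul_eq_mul,
      Set.inter_comm (Metric.ball x r), mul_comm, div_eq_mul_inv (volume _)]
  have hexp : Tendsto (fun n : ℕ => Real.exp (-τ * n)) atTop (nhds 0) :=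
    Real.tendsto_exp_atBot.comp
      (tendsto_natCast_atTop_atTop.const_mul_atTop_of_neg (by linarith))
  have hpos : ∀ᶠ n : ℕ in atTop, volume (EnSet A l₁ l₂ γ β τ n ∩ unitCube) ≠ 0 ∧
      volume (EnSet A l₁ l₂ γ β τ n ∩ unitCube) ≠ ⊤ := by
    filter_upwards [eventually_ge_atTop 1,
      hexp.eventually (gt_mem_nhds (by norm_num : (0 : ℝ) < 1 / 2))] with n hn hε
    rw [volume_EnSet_inter_unitCube_eq_exp A h0 h1 h2 hne hγ hβ hn hε]
    refine ⟨?_, ENNReal.ofReal_ne_top⟩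
    have : 0 < |γ - β| := abs_pos.2 (sub_ne_zero.2 hne)
    rw [← pos_iff_ne_zero, ENNReal.ofReal_pos]
    positivity
  have hc0 : ENNReal.ofReal c / w ≠ 0 :=
    ENNReal.div_ne_zero.2 ⟨(ENNReal.ofReal_pos.2 hc).ne', hwt⟩
  refine ⟨max 2 (max (K / w) (ENNReal.ofReal c / w)⁻¹), ?_, ?_, ?_, ?_⟩
  · exact lt_of_lt_of_le (by norm_num) (le_max_left _ _)
  · refine max_lt (by norm_num) (max_lt ?_ ?_)
    · exact ENNReal.div_lt_top hK hw0
    · exact ENNReal.inv_lt_top.2 (pos_iff_ne_zero.2 hc0)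
  · refine le_liminf_of_le (by isBoundedDefault) ?_
    filter_upwards [hlower, hpos] with n hn hv
    rw [hratio]
    refine (ENNReal.inv_le_inv.2 ((le_max_right _ _).trans (le_max_right _ _))).trans ?_
    rw [inv_inv]
    gcongr
    exact (ENNReal.le_div_iff_mul_le (Or.inl hv.1) (Or.inl hv.2)).2 hn
  · refine limsup_le_of_le (by isBoundedDefault) ?_
    filter_upwards [eventually_ge_atTop 1] with n hn
    rw [hratio]
    refine le_trans ?_ ((le_max_left _ _).trans (le_max_right _ _))
    gcongr
    exact ENNReal.div_le_of_le_mul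
      (hupper _ (mem_EnSet_of_add_intVec_mem A h0 h1 h2 hne hγ hβ hn))
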